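/- Let α, β ∈ (0,1) be real and let μ > 1 be a real number such that none of μ, μ−α, μ−β, μ−α−β is an integer. Then the function x ↦ ₃F₂(1, 1, 1−μ; 2−α, 2−β; x), defined for real x ∈ (−1,1), is not the restriction of a rational function: there exist no real polynomials p, q with q not identically zero such that q(x)·₃F₂(1, 1, 1−μ; 2−α, 2−β; x) = p(x) for all x ∈ (−1,1). -/

import Mathlib

open Set

/-- Pochhammer symbol `(a)_n` for real `a`. -/
noncomputable def poch (a : ℝ) (n : ℕ) : ℝ := (ascPochhammer ℝ n).eval a

/-- Generalized hypergeometric function `₃F₂(a₁,a₂,a₃;b₁,b₂;x)` (real version). -/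
noncomputable def hyp3F2 (a₁ a₂ a₃ b₁ b₂ x : ℝ) : ℝ :=
  ∑' n : ℕ, poch a₁ n * poch a₂ n * poch a₃ n /
    (poch b₁ n * poch b₂ n * (n.factorial : ℝ)) * x ^ n

open Polynomial in
/-- The shifts of a nonvanishing hypergeometric sequence with term ratio `N / D` are linearly
independent near infinity, if some root `r` of `D` has no `r - j` among the roots of `N`. -/
theorem eq_zero_of_sum_shift_eq_zero {c : ℕ → ℝ} {N D : ℝ[X]} {r : ℝ}
    (hc : ∀ n, c n ≠ 0) (hrec : ∀ n : ℕ, c (n + 1) * D.eval (n : ℝ) = c n * N.eval (n : ℝ))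
    (hD : D.eval r = 0) (hN : ∀ j : ℕ, N.eval (r - j) ≠ 0) (M : ℕ) (a : ℕ → ℝ) (K : ℕ)
    (h : ∀ m ≥ M, ∑ i ∈ Finset.range K, a i * c (m + i) = 0) :
    ∀ i < K, a i = 0 := by
  induction K with
  | zero => simp
  | succ K ih =>
    have hshift : ∀ m i : ℕ, c (m + i) * ∏ k ∈ Finset.range i, D.eval ((m : ℝ) + k) =
        c m * ∏ k ∈ Finset.range i, N.eval ((m : ℝ) + k) := by
      intro m i
      induction i with
      | zero => simp
      | succ i ihi =>
        rw [Finset.prod_range_succ, Finset.prod_range_succ, ← mul_assoc (c m), ← ihi]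
        have := hrec (m + i)
        push_cast at this
        linear_combination (∏ k ∈ Finset.range i, D.eval ((m : ℝ) + k)) * this
    let P : ℝ[X] := ∑ i ∈ Finset.range (K + 1), C (a i) *
      ((∏ k ∈ Finset.range i, N.comp (X + C (k : ℝ))) *
        ∏ k ∈ Finset.Ico i K, D.comp (X + C (k : ℝ)))
    have hPeval : ∀ x, P.eval x = ∑ i ∈ Finset.range (K + 1), a i *
        ((∏ k ∈ Finset.range i, N.eval (x + k)) * ∏ k ∈ Finset.Ico i K, D.eval (x + k)) := by
      intro x
      simp [P, eval_finsetSum, eval_prod]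
    have hroot : ∀ m ≥ M, P.eval (m : ℝ) = 0 := by
      intro m hm
      apply (mul_eq_zero.mp _).resolve_left (hc m)
      calc c m * P.eval (m : ℝ)
          = (∑ i ∈ Finset.range (K + 1), a i * c (m + i)) *
              ∏ k ∈ Finset.range K, D.eval ((m : ℝ) + k) := by
            rw [hPeval, Finset.mul_sum, Finset.sum_mul]
            refine Finset.sum_congr rfl fun i hi => ?_
            rw [← Finset.prod_range_mul_prod_Ico _ (Nat.lt_succ_iff.mp (Finset.mem_range.mp hi))]
            linear_combination -(a i * ∏ k ∈ Finset.Ico i K, D.eval ((m : ℝ) + k)) * hshift m i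
        _ = 0 := by rw [h m hm, zero_mul]
    have hP : P = 0 := by
      refine eq_zero_of_infinite_isRoot P ?_
      refine ((Set.Ici_infinite M).image (f := fun n : ℕ => (n : ℝ))
        Nat.cast_injective.injOn).mono ?_
      rintro _ ⟨m, hm, rfl⟩
      exact hroot m hm
    have htop : a K = 0 := by
      have h0 := hPeval (r - K + 1)
      rw [hP, eval_zero, Finset.sum_range_succ, Finset.sum_eq_zero] at h0
      · simp only [Finset.Ico_self, Finset.prod_empty, mul_one, zero_add] at h0
        refine (mul_eq_zero.mp h0.symm).resolve_right (Finset.prod_ne_zero_iff.mpr ?_)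
        intro k hk
        obtain ⟨j, rfl⟩ := Nat.exists_eq_add_of_lt (Finset.mem_range.mp hk)
        convert hN j using 2
        push_cast
        ring
      · intro i hi
        have hi' := Finset.mem_range.mp hi
        have hz : ∏ k ∈ Finset.Ico i K, D.eval (r - K + 1 + k) = 0 := by
          refine Finset.prod_eq_zero (i := K - 1) (Finset.mem_Ico.mpr ⟨by omega, by omega⟩) ?_
          rw [Nat.cast_sub (by omega)]
          convert hD using 2
          push_cast
          ring
        rw [hz, mul_zero, mul_zero]
    intro i hi
    rcases Nat.lt_succ_iff_lt_or_eq.mp hi with hi | rfl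
    · refine ih (fun m hm => ?_) i hi
      simpa [Finset.sum_range_succ, htop] using h m hm
    · exact htop

/-- A convergent power series is determined by its sum near the origin. -/
theorem eq_of_hasSum_pow {a b : ℕ → ℝ} {f : ℝ → ℝ}
    (ha : ∀ x ∈ Ioo (-1 : ℝ) 1, HasSum (fun n => a n * x ^ n) (f x))
    (hb : ∀ x ∈ Ioo (-1 : ℝ) 1, HasSum (fun n => b n * x ^ n) (f x)) : a = b := by
  have key : ∀ a : ℕ → ℝ, (∀ x ∈ Ioo (-1 : ℝ) 1, HasSum (fun n => a n * x ^ n) (f x)) →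
      HasFPowerSeriesAt f (FormalMultilinearSeries.ofScalars ℝ a) 0 := by
    intro a ha
    rw [hasFPowerSeriesAt_iff]
    filter_upwards [Ioo_mem_nhds (show (-1 : ℝ) < 0 by norm_num) one_pos] with x hx
    simpa [FormalMultilinearSeries.coeff_ofScalars, mul_comm] using ha x hx
  have := (key a ha).eq_formalMultilinearSeries (key b hb)
  funext n
  simpa [FormalMultilinearSeries.coeff_ofScalars] using
    congrArg (fun s : FormalMultilinearSeries ℝ ℝ ℝ => s.coeff n) this

theorem Polynomial.hasSum_coeff_mul_pow (p : Polynomial ℝ) (x : ℝ) :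
    HasSum (fun n => p.coeff n * x ^ n) (p.eval x) := by
  rw [Polynomial.eval_eq_sum_range]
  refine hasSum_sum_of_ne_finset_zero fun n hn => ?_
  rw [Polynomial.coeff_eq_zero_of_natDegree_lt (by simpa using hn), zero_mul]

/-- A power series representing a rational function has coefficients satisfying the
convolution identity. -/
theorem sum_antidiagonal_coeff_mul_eq {c : ℕ → ℝ} {p q : Polynomial ℝ}
    (hc : ∀ x ∈ Ioo (-1 : ℝ) 1, Summable fun n => c n * x ^ n)
    (h : ∀ x ∈ Ioo (-1 : ℝ) 1, q.eval x * ∑' n, c n * x ^ n = p.eval x) (n : ℕ) :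
    ∑ ij ∈ Finset.HasAntidiagonal.antidiagonal n, q.coeff ij.1 * c ij.2 = p.coeff n := by
  refine congrFun (eq_of_hasSum_pow
    (a := fun n => ∑ ij ∈ Finset.HasAntidiagonal.antidiagonal n, q.coeff ij.1 * c ij.2)
    (f := fun x => p.eval x) (fun x hx => ?_) fun x _ => p.hasSum_coeff_mul_pow x) n
  have hq := q.hasSum_coeff_mul_pow x
  have hs := summable_norm_sum_mul_antidiagonal_of_summable_norm hq.summable.norm (hc x hx).norm
  have ht := tsum_mul_tsum_eq_tsum_sum_antidiagonal_of_summable_norm hq.summable.norm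
    (hc x hx).norm
  rw [hq.tsum_eq, h x hx] at ht
  rw [ht]
  have hterm : (fun k => (∑ ij ∈ Finset.HasAntidiagonal.antidiagonal k,
      q.coeff ij.1 * c ij.2) * x ^ k) = fun k =>
      ∑ ij ∈ Finset.HasAntidiagonal.antidiagonal k,
        q.coeff ij.1 * x ^ ij.1 * (c ij.2 * x ^ ij.2) := by
    funext k
    rw [Finset.sum_mul]
    refine Finset.sum_congr rfl fun ij hij => ?_
    rw [← Finset.HasAntidiagonal.mem_antidiagonal.mp hij, pow_add]
    ring
  rw [hterm]
  exact hs.of_norm.hasSum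

theorem poch_succ (a : ℝ) (n : ℕ) : poch a (n + 1) = poch a n * (a + n) :=
  ascPochhammer_succ_eval n a

theorem poch_ne_zero {a : ℝ} (h : ∀ n : ℕ, a + n ≠ 0) (n : ℕ) : poch a n ≠ 0 := by
  induction n with
  | zero => simp [poch]
  | succ n ih => rw [poch_succ]; exact mul_ne_zero ih (h n)

/-- A sequence with term ratio tending to one is summable against `x ^ n` for `|x| < 1`. -/
theorem summable_mul_pow_of_ratio_tendsto_one {c : ℕ → ℝ} (hc : ∀ n, c n ≠ 0)
    (h : Filter.Tendsto (fun n => c (n + 1) / c n) Filter.atTop (nhds 1)) {x : ℝ}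
    (hx : x ∈ Ioo (-1 : ℝ) 1) : Summable fun n => c n * x ^ n := by
  rcases eq_or_ne x 0 with rfl | hx0
  · refine summable_of_ne_finset_zero (s := {0}) fun n hn => ?_
    rw [zero_pow (by simpa using hn), mul_zero]
  · refine summable_of_ratio_test_tendsto_lt_one (l := |x|) (abs_lt.mpr hx)
      (Filter.Eventually.of_forall fun n => mul_ne_zero (hc n) (pow_ne_zero n hx0)) ?_
    have h2 := (h.mul_const x).abs
    rw [one_mul] at h2
    refine h2.congr fun n => ?_
    rw [← norm_div, Real.norm_eq_abs]
    congr 1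
    have := hc n
    field_simp
    ring

theorem tendsto_natCast_add_div_natCast_add (a b : ℝ) :
    Filter.Tendsto (fun n : ℕ => ((n : ℝ) + a) / (n + b)) Filter.atTop (nhds 1) := by
  have h := fun a : ℝ => (tendsto_const_div_atTop_nhds_zero_nat a).const_add 1
  have h2 := (h a).div (h b) (by simp)
  simp only [add_zero, div_one] at h2
  refine h2.congr' ?_
  filter_upwards [Filter.eventually_gt_atTop 0] with n hn
  have : (n : ℝ) ≠ 0 := by positivity
  simp only [Pi.div_apply]
  rw [← mul_div_mul_left _ _ this]
  congr 1 <;> field_simp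

/-- for `α, β ∈ (0,1)` and real `μ > 1` with none of `μ, μ−α, μ−β, μ−α−β`
an integer, the function `x ↦ ₃F₂(1,1,1−μ;2−α,2−β;x)` on `(−1,1)` is not the restriction
of a rational function. -/
theorem stmt16 (α β μ : ℝ) (hα : α ∈ Ioo (0 : ℝ) 1) (hβ : β ∈ Ioo (0 : ℝ) 1)
    (hμ : 1 < μ)
    (h1 : ∀ k : ℤ, μ ≠ (k : ℝ)) (h2 : ∀ k : ℤ, μ - α ≠ (k : ℝ))
    (h3 : ∀ k : ℤ, μ - β ≠ (k : ℝ)) (h4 : ∀ k : ℤ, μ - α - β ≠ (k : ℝ)) :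
    ¬ ∃ p q : Polynomial ℝ, q ≠ 0 ∧
      ∀ x ∈ Ioo (-1 : ℝ) 1,
        q.eval x * hyp3F2 1 1 (1 - μ) (2 - α) (2 - β) x = p.eval x := by
  rintro ⟨p, q, hq, h⟩
  obtain ⟨hα0, hα1⟩ := hα
  obtain ⟨hβ0, hβ1⟩ := hβ
  have hα2 : ∀ n : ℕ, 2 - α + n ≠ 0 := fun n => by
    have : (0 : ℝ) ≤ n := n.cast_nonneg
    linarith
  have hβ2 : ∀ n : ℕ, 2 - β + n ≠ 0 := fun n => by
    have : (0 : ℝ) ≤ n := n.cast_nonneg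
    linarith
  have hone : ∀ n : ℕ, (1 : ℝ) + n ≠ 0 := fun n => by positivity
  have hμn : ∀ n : ℕ, 1 - μ + n ≠ 0 := fun n hn => h1 (n + 1) (by push_cast; linarith)
  let c : ℕ → ℝ := fun n => poch 1 n * poch 1 n * poch (1 - μ) n /
    (poch (2 - α) n * poch (2 - β) n * (n.factorial : ℝ))
  have hc : ∀ n, c n ≠ 0 := fun n =>
    div_ne_zero (mul_ne_zero (mul_ne_zero (poch_ne_zero hone n) (poch_ne_zero hone n))
      (poch_ne_zero hμn n)) (mul_ne_zero (mul_ne_zero (poch_ne_zero hα2 n) (poch_ne_zero hβ2 n))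
      (Nat.cast_ne_zero.mpr n.factorial_ne_zero))
  have hratio : ∀ n : ℕ, c (n + 1) / c n =
      ((n : ℝ) + 1) / (n + (2 - α)) * ((n + (1 - μ)) / (n + (2 - β))) := by
    intro n
    have e1 := poch_ne_zero hone n
    have e2 := poch_ne_zero hμn n
    have e3 := poch_ne_zero hα2 n
    have e4 := poch_ne_zero hβ2 n
    have e5 : (n.factorial : ℝ) ≠ 0 := Nat.cast_ne_zero.mpr n.factorial_ne_zero
    have e6 := hα2 n
    have e7 := hβ2 n
    have e8 : (n : ℝ) + 1 ≠ 0 := by positivity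
    simp only [c, poch_succ, Nat.factorial_succ, Nat.cast_mul, Nat.cast_succ]
    rw [add_comm (n : ℝ) (2 - α), add_comm (n : ℝ) (2 - β), add_comm (n : ℝ) (1 - μ),
      add_comm (1 : ℝ) n]
    generalize 2 - α + (n : ℝ) = A at *
    generalize 2 - β + (n : ℝ) = B at *
    field_simp
  have hlim : Filter.Tendsto (fun n => c (n + 1) / c n) Filter.atTop (nhds 1) := by
    simp only [hratio]
    simpa using (tendsto_natCast_add_div_natCast_add 1 (2 - α)).mul
      (tendsto_natCast_add_div_natCast_add (1 - μ) (2 - β))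
  have hconv := sum_antidiagonal_coeff_mul_eq (c := c)
    (fun x hx => summable_mul_pow_of_ratio_tendsto_one hc hlim hx) h
  have hsum : ∀ m ≥ p.natDegree + 1, ∑ i ∈ Finset.range (q.natDegree + 1),
      q.coeff (q.natDegree - i) * c (m + i) = 0 := by
    intro m hm
    have hn := hconv (m + q.natDegree)
    rw [Polynomial.coeff_eq_zero_of_natDegree_lt (by omega),
      Finset.Nat.sum_antidiagonal_eq_sum_range_succ (fun i j => q.coeff i * c j),
      ← Finset.sum_subset (Finset.range_mono (by omega : q.natDegree + 1 ≤ _)),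
      ← Finset.sum_range_reflect] at hn
    · rw [← hn]
      refine Finset.sum_congr rfl fun i hi => ?_
      have := Finset.mem_range.mp hi
      congr 2
      omega
    · intro i _ hi
      rw [Polynomial.coeff_eq_zero_of_natDegree_lt (by simpa using hi), zero_mul]
  have hz := eq_zero_of_sum_shift_eq_zero (r := α - 2)
    (N := (Polynomial.X + Polynomial.C 1) * (Polynomial.X + Polynomial.C (1 - μ)))
    (D := (Polynomial.X + Polynomial.C (2 - α)) * (Polynomial.X + Polynomial.C (2 - β)))
    hc (fun n => ?_) (by simp) (fun j => ?_) _ (fun i => q.coeff (q.natDegree - i)) _ hsum 0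
    (Nat.succ_pos _)
  · exact hq (Polynomial.leadingCoeff_eq_zero.mp hz)
  · have e := hratio n
    have e6 : (n : ℝ) + (2 - α) ≠ 0 := by rw [add_comm]; exact hα2 n
    have e7 : (n : ℝ) + (2 - β) ≠ 0 := by rw [add_comm]; exact hβ2 n
    simp only [Polynomial.eval_mul, Polynomial.eval_add, Polynomial.eval_X, Polynomial.eval_C]
    rw [div_mul_div_comm, div_eq_div_iff (hc n) (mul_ne_zero e6 e7)] at e
    linear_combination e
  · have : (0 : ℝ) ≤ j := j.cast_nonneg
    simp only [Polynomial.eval_mul, Polynomial.eval_add, Polynomial.eval_X, Polynomial.eval_C]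
    exact mul_ne_zero (by linarith) (by linarith)
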